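/- For every integer n ≥ 2 and every natural number ν, C_n(ν) = S_n − 2·Σ_{l=1}^{ν} cot((2l − 1)π/(2n)). -/

import Mathlib

open Real Finset

/-- `C n ν = Σ_{l=1}^{n-1} cos(2πνl/n) · csc(πl/n)`. -/
noncomputable def C (n : ℕ) (ν : ℤ) : ℝ :=
  ∑ l ∈ Finset.Icc 1 (n - 1), Real.cos (2 * π * ν * l / n) / Real.sin (π * l / n)

/-- Watson's sum `S n = Σ_{l=1}^{n-1} csc(πl/n)`. -/
noncomputable def S (n : ℕ) : ℝ :=
  ∑ l ∈ Finset.Icc 1 (n - 1), 1 / Real.sin (π * l / n)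

theorem two_mul_sin_half_mul_sum_sin (θ : ℝ) (m : ℕ) :
    2 * Real.sin (θ / 2) * ∑ l ∈ Finset.Icc 1 m, Real.sin (l * θ) =
      Real.cos (θ / 2) - Real.cos (m * θ + θ / 2) := by
  induction m with
  | zero => simp
  | succ k ih =>
    rw [Finset.sum_Icc_succ_top (by omega), mul_add, ih]
    have h₁ : (k : ℝ) * θ + θ / 2 = ((k + 1 : ℕ) : ℝ) * θ - θ / 2 := by push_cast; ring
    rw [h₁, Real.cos_sub, Real.cos_add]
    ring

theorem sin_odd_mul_pi_div_two_mul_ne_zero (n : ℕ) (hn : n ≠ 0) (k : ℕ) :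
    Real.sin ((2 * (k : ℝ) + 1) * π / (2 * n)) ≠ 0 := by
  have hn' : (n : ℝ) ≠ 0 := Nat.cast_ne_zero.mpr hn
  intro h
  obtain ⟨j, hj⟩ := Real.sin_eq_zero_iff.mp h
  rw [eq_div_iff (by positivity)] at hj
  have h₁ : (j : ℝ) * (2 * n) = 2 * k + 1 :=
    mul_right_cancel₀ Real.pi_ne_zero (by linear_combination hj)
  have h₂ : j * (2 * n) = 2 * k + 1 := by exact_mod_cast h₁
  have h₃ : 2 * (j * n) = 2 * (k : ℤ) + 1 := by linear_combination h₂
  omega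

theorem sum_sin_odd_mul_pi_div (n : ℕ) (hn : n ≠ 0) (k : ℕ) :
    ∑ l ∈ Finset.Icc 1 (n - 1), Real.sin (l * ((2 * (k : ℝ) + 1) * π / n)) =
      Real.cot ((2 * (k : ℝ) + 1) * π / (2 * n)) := by
  have hn' : (n : ℝ) ≠ 0 := Nat.cast_ne_zero.mpr hn
  have hs := sin_odd_mul_pi_div_two_mul_ne_zero n hn k
  have h := two_mul_sin_half_mul_sum_sin ((2 * (k : ℝ) + 1) * π / n) (n - 1)
  have hhalf : (2 * (k : ℝ) + 1) * π / n / 2 = (2 * (k : ℝ) + 1) * π / (2 * n) := by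
    field_simp
  have hend : ((n - 1 : ℕ) : ℝ) * ((2 * (k : ℝ) + 1) * π / n) + (2 * (k : ℝ) + 1) * π / (2 * n) =
      π - (2 * (k : ℝ) + 1) * π / (2 * n) + k * (2 * π) := by
    rw [Nat.cast_pred (Nat.pos_of_ne_zero hn)]
    field_simp
    ring
  rw [hhalf, hend, Real.cos_add_nat_mul_two_pi, Real.cos_pi_sub] at h
  rw [Real.cot_eq_cos_div_sin, eq_div_iff hs]
  linear_combination h / 2

theorem C_succ (n : ℕ) (k : ℕ) :
    C n ((k + 1 : ℕ) : ℤ) = C n (k : ℤ) -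
      2 * ∑ l ∈ Finset.Icc 1 (n - 1), Real.sin (l * ((2 * (k : ℝ) + 1) * π / n)) := by
  unfold C
  rw [Finset.mul_sum, ← Finset.sum_sub_distrib]
  refine Finset.sum_congr rfl fun l hl => ?_
  obtain ⟨hl₁, hl₂⟩ := Finset.mem_Icc.mp hl
  have hn : (0 : ℝ) < n := by exact_mod_cast (by omega : 0 < n)
  have hl₀ : (0 : ℝ) < l := by exact_mod_cast hl₁
  have hln : (l : ℝ) < n := by exact_mod_cast (by omega : l < n)
  have hs : Real.sin (π * l / n) ≠ 0 := by
    refine (Real.sin_pos_of_pos_of_lt_pi (by positivity) ?_).ne'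
    rw [div_lt_iff₀ hn]
    exact mul_lt_mul_of_pos_left hln Real.pi_pos
  have h₁ : 2 * π * (((k + 1 : ℕ) : ℤ) : ℝ) * l / n =
      l * ((2 * (k : ℝ) + 1) * π / n) + π * l / n := by
    push_cast
    ring
  have h₂ : 2 * π * ((k : ℤ) : ℝ) * l / n =
      l * ((2 * (k : ℝ) + 1) * π / n) - π * l / n := by
    push_cast
    ring
  rw [h₁, h₂, Real.cos_add, Real.cos_sub]
  generalize l * ((2 * (k : ℝ) + 1) * π / n) = a
  generalize π * l / n = b at hs ⊢
  field_simp
  ring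

theorem C_eq_S_sub_cot_sum (n : ℕ) (hn : 2 ≤ n) (ν : ℕ) :
    C n (ν : ℤ) = S n - 2 * ∑ l ∈ Finset.Icc 1 ν, Real.cot ((2 * (l : ℝ) - 1) * π / (2 * n)) := by
  induction ν with
  | zero => simp [C, S]
  | succ k ih =>
    have h : (2 * ((k + 1 : ℕ) : ℝ) - 1) * π / (2 * n) = (2 * (k : ℝ) + 1) * π / (2 * n) := by
      push_cast
      ring
    rw [C_succ, ih, sum_sin_odd_mul_pi_div n (by omega), Finset.sum_Icc_succ_top (by omega), h]
    ring
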